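/- Proposition (reduction to a lattice triangle or segment inside a globally generated polygon). Let b ∈ ℤⁿ be such that P(b) is globally generated and two-dimensional, let σ = σ_1(b) = P(b) ∩ {u : ⟨u, v_1⟩ = -b_1} be a one-dimensional face (an edge) of P(b), and let q ∈ σ. Then there exists c ∈ ℤⁿ with c_1 = b_1 and c_i ≤ b_i for all i, such that q ∈ P(c) ⊆ P(b), both endpoints of σ are extreme points of P(c), and either P(c) = σ, or P(c) is a triangle all of whose vertices lie in ℤ² and whose three edges lie on the lines {u : ⟨u, v_1⟩ = -c_1}, {u : ⟨u, v_k⟩ = -c_k} and {u : ⟨u, v_{k+1}⟩ = -c_{k+1}} for some k (so in the latter case P(c) is a globally generated polygon having nondegenerate edges with two consecutive inner normals v_k and v_{k+1}). -/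

import Mathlib

open scoped Pointwise

/-- The real vector in `ℝ²` corresponding to an integer vector. -/
def vecR (m : ℤ × ℤ) : ℝ × ℝ := ((m.1 : ℝ), (m.2 : ℝ))

/-- The standard inner (dot) product on `ℝ²`. -/
def dotR (u w : ℝ × ℝ) : ℝ := u.1 * w.1 + u.2 * w.2

/-- The standard lattice `ℤ²` viewed inside `ℝ²`. -/
def latticeR2 : Set (ℝ × ℝ) := {u | ∃ m : ℤ × ℤ, u = vecR m}

/-- The data of a complete smooth fan in `ℝ²`: `n` primitive integer vectors
`v 0, …, v (n-1)` (indices modulo `n`) such that `det (v i, v (i+1)) = 1` for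
every `i`, and such that the rays through the `v i`, taken in this cyclic
order, wind exactly once counterclockwise around the origin.  The last
condition is expressed by saying that every nonzero vector of `ℝ²` lies in
exactly one of the half-open cones `{s • v i + t • v (i+1) : s ≥ 0, t > 0}`. -/
def IsCompleteSmoothFan (n : ℕ) (v : ZMod n → ℤ × ℤ) : Prop :=
  (∀ i, IsCoprime (v i).1 (v i).2) ∧
  (∀ i, (v i).1 * (v (i + 1)).2 - (v i).2 * (v (i + 1)).1 = 1) ∧
  (∀ u : ℝ × ℝ, u ≠ 0 →
    ∃! i : ZMod n, ∃ s t : ℝ, 0 ≤ s ∧ 0 < t ∧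
      u = s • vecR (v i) + t • vecR (v (i + 1)))

/-- `Pgon n v a = P(a) = {u ∈ ℝ² : ⟨u, v i⟩ ≥ -a i for all i}`. -/
def Pgon (n : ℕ) (v : ZMod n → ℤ × ℤ) (a : ZMod n → ℤ) : Set (ℝ × ℝ) :=
  {u | ∀ i, -(a i : ℝ) ≤ dotR u (vecR (v i))}

/-- `face n v a i = σ_i(a) = P(a) ∩ {u : ⟨u, v i⟩ = -a i}`. -/
def face (n : ℕ) (v : ZMod n → ℤ × ℤ) (a : ZMod n → ℤ) (i : ZMod n) :
    Set (ℝ × ℝ) :=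
  {u ∈ Pgon n v a | dotR u (vecR (v i)) = -(a i : ℝ)}

/-- `P(a)` is ample: each face `σ_i(a)` is one-dimensional, i.e. a
nondegenerate segment (it contains two distinct points). -/
def IsAmplePgon (n : ℕ) (v : ZMod n → ℤ × ℤ) (a : ZMod n → ℤ) : Prop :=
  ∀ i, ∃ x ∈ face n v a i, ∃ y ∈ face n v a i, x ≠ y

/-- `P(a)` is globally generated: `P(a)` is nonempty, the minimum of
`⟨·, v i⟩` over `P(a)` equals `-a i` for every `i` (equivalently each face
`σ_i(a)` is nonempty), and every extreme point of `P(a)` is a lattice point. -/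
def IsGGPgon (n : ℕ) (v : ZMod n → ℤ × ℤ) (a : ZMod n → ℤ) : Prop :=
  (Pgon n v a).Nonempty ∧
  (∀ i, (face n v a i).Nonempty) ∧
  ∀ u ∈ Set.extremePoints ℝ (Pgon n v a), u ∈ latticeR2


lemma aux_dot_add (u w x : ℝ × ℝ) (s t : ℝ) :
    dotR u (s • w + t • x) = s * dotR u w + t * dotR u x := by
  simp [dotR]; ring

lemma aux_dot_comb (u w x : ℝ × ℝ) (s t : ℝ) :
    dotR (s • u + t • w) x = s * dotR u x + t * dotR w x := by
  simp [dotR]; ring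

lemma aux_dot_neg (u w : ℝ × ℝ) : dotR u (-w) = - dotR u w := by
  simp [dotR]; ring

lemma aux_convex (n : ℕ) (v : ZMod n → ℤ × ℤ) (a : ZMod n → ℤ) : Convex ℝ (Pgon n v a) := by
  intro x hx y hy s t hs ht hst i
  rw [aux_dot_comb]
  have h1 := mul_le_mul_of_nonneg_left (hx i) hs
  have h2 := mul_le_mul_of_nonneg_left (hy i) ht
  have : t = 1 - s := by linarith
  subst this
  linarith

lemma aux_ext (x y u w : ℝ × ℝ) (hd : x.1 * y.2 - x.2 * y.1 = 1)
    (h1 : dotR u x = dotR w x) (h2 : dotR u y = dotR w y) : u = w := by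
  unfold dotR at h1 h2
  ext
  · linear_combination y.2 * h1 - x.2 * h2 - (u.1 - w.1) * hd
  · linear_combination x.1 * h2 - y.1 * h1 - (u.2 - w.2) * hd

lemma aux_face_ext (n : ℕ) (v : ZMod n → ℤ × ℤ) (b : ZMod n → ℤ) (j : ZMod n)
    (m₁ m₂ : ℝ × ℝ) (hσ : face n v b j = segment ℝ m₁ m₂) :
    m₁ ∈ Set.extremePoints ℝ (Pgon n v b) := by
  have hm1 : m₁ ∈ face n v b j := hσ ▸ left_mem_segment ℝ _ _
  rw [mem_extremePoints]
  refine ⟨hm1.1, ?_⟩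
  intro x hx y hy hxy
  obtain ⟨s, t, hs, ht, hst, h⟩ := hxy
  have hd := hm1.2
  rw [← h, aux_dot_comb] at hd
  have h1 := hx j
  have h2 := hy j
  have hs1 : t = 1 - s := by linarith
  have e1 : dotR x (vecR (v j)) = -(b j : ℝ) := by
    subst hs1; nlinarith
  have e2 : dotR y (vecR (v j)) = -(b j : ℝ) := by
    subst hs1; nlinarith
  have f1 : x ∈ segment ℝ m₁ m₂ := hσ ▸ ⟨hx, e1⟩
  have f2 : y ∈ segment ℝ m₁ m₂ := hσ ▸ ⟨hy, e2⟩
  rw [segment_eq_image'] at f1 f2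
  obtain ⟨α, ⟨hα, -⟩, rfl⟩ := f1
  obtain ⟨β, ⟨hβ, -⟩, rfl⟩ := f2
  have key : (s * α + t * β) • (m₂ - m₁) = 0 := by
    have : s • (m₁ + α • (m₂ - m₁)) + t • (m₁ + β • (m₂ - m₁))
        = m₁ + (s * α + t * β) • (m₂ - m₁) := by
      subst hs1; module
    simp only at h
    rw [this] at h
    simpa using h
  rcases smul_eq_zero.mp key with h0 | h0
  · have a0 : α = 0 := by
      have := mul_nonneg hs.le hα
      have := mul_nonneg ht.le hβ
      have : s * α = 0 := by linarith
      rcases mul_eq_zero.mp this with h | h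
      · linarith
      · exact h
    have b0 : β = 0 := by
      have := mul_nonneg hs.le hα
      have := mul_nonneg ht.le hβ
      have : t * β = 0 := by linarith
      rcases mul_eq_zero.mp this with h | h
      · linarith
      · exact h
    simp [a0, b0]
  · simp [h0]

def idot (m w : ℤ × ℤ) : ℤ := m.1 * w.1 + m.2 * w.2

lemma idot_cast (m w : ℤ × ℤ) : ((idot m w : ℤ) : ℝ) = dotR (vecR m) (vecR w) := by
  simp [idot, dotR, vecR]

/-- half-plane membership for every ray of the fan -/
lemma aux_cone (n : ℕ) (v : ZMod n → ℤ × ℤ) (hv : IsCompleteSmoothFan n v)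
    (k i : ZMod n) (s t : ℝ) (hs : 0 < s) (ht : 0 < t)
    (h : -vecR (v 1) = s • vecR (v k) + t • vecR (v (k + 1))) :
    (∃ α β : ℝ, 0 ≤ α ∧ 0 ≤ β ∧ vecR (v i) = α • vecR (v 1) + β • vecR (v (k + 1))) ∨
    (∃ α β : ℝ, 0 ≤ α ∧ 0 ≤ β ∧ vecR (v i) = α • vecR (v 1) + β • vecR (v k)) := by
  obtain ⟨hcop, hdet, hun⟩ := hv
  have hd := hdet k
  have hdR : ((v k).1 : ℝ) * (v (k+1)).2 - (v k).2 * (v (k+1)).1 = 1 := by exact_mod_cast hd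
  obtain ⟨x, y, hxy⟩ : ∃ x y : ℝ, vecR (v i) = x • vecR (v k) + y • vecR (v (k + 1)) := by
    refine ⟨(v i).1 * (v (k+1)).2 - (v i).2 * (v (k+1)).1,
      (v k).1 * (v i).2 - (v k).2 * (v i).1, ?_⟩
    ext <;> simp [vecR]
    · linear_combination (-((v i).1 : ℝ)) * hdR
    · linear_combination (-((v i).2 : ℝ)) * hdR
  have hk : vecR (v k) = (-1 / s) • vecR (v 1) + (-t / s) • vecR (v (k+1)) := by
    have : vecR (v 1) = - (s • vecR (v k) + t • vecR (v (k + 1))) := by rw [← h]; simp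
    rw [this]
    match_scalars <;> field_simp <;> ring
  have hk1 : vecR (v (k+1)) = (-1 / t) • vecR (v 1) + (-s / t) • vecR (v k) := by
    have : vecR (v 1) = - (s • vecR (v k) + t • vecR (v (k + 1))) := by rw [← h]; simp
    rw [this]
    match_scalars <;> field_simp <;> ring
  have hnot : x ≤ 0 ∨ y ≤ 0 := by
    by_contra hcon
    push Not at hcon
    have hne : vecR (v i) ≠ 0 := by
      intro h0
      have h1 := hdet i
      have a1 : (v i).1 = 0 := by simpa [vecR] using congrArg Prod.fst h0
      have a2 : (v i).2 = 0 := by simpa [vecR] using congrArg Prod.snd h0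
      simp [a1, a2] at h1
    have := (hun _ hne).unique (y₁ := k) (y₂ := i - 1) ⟨x, y, hcon.1.le, hcon.2, hxy⟩
      ⟨0, 1, le_rfl, one_pos, by simp⟩
    have hi : i = k + 1 := by rw [this]; ring
    subst hi
    have e1 := congrArg Prod.fst hxy
    have e2 := congrArg Prod.snd hxy
    simp [vecR] at e1 e2
    have : x = 0 := by
      linear_combination (-x) * hdR - ((v (k+1)).2 : ℝ) * e1 + ((v (k+1)).1 : ℝ) * e2
    linarith
  have L : x ≤ 0 → 0 ≤ y * s - x * t → (∃ α β : ℝ, 0 ≤ α ∧ 0 ≤ β ∧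
      vecR (v i) = α • vecR (v 1) + β • vecR (v (k + 1))) := by
    intro hx hyx
    refine ⟨-x / s, (y * s - x * t) / s, div_nonneg (by linarith) hs.le,
      div_nonneg hyx hs.le, ?_⟩
    rw [hxy]
    nth_rw 1 [hk]
    match_scalars <;> field_simp <;> ring
  have R : y ≤ 0 → 0 ≤ x * t - y * s → (∃ α β : ℝ, 0 ≤ α ∧ 0 ≤ β ∧
      vecR (v i) = α • vecR (v 1) + β • vecR (v k)) := by
    intro hx hyx
    refine ⟨-y / t, (x * t - y * s) / t, div_nonneg (by linarith) ht.le,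
      div_nonneg hyx ht.le, ?_⟩
    rw [hxy]
    nth_rw 1 [hk1]
    match_scalars <;> field_simp <;> ring
  rcases le_total 0 (y * s - x * t) with h0 | h0
  · by_cases hx : x ≤ 0
    · exact Or.inl (L hx h0)
    · have hy : y ≤ 0 := by tauto
      push Not at hx
      have := mul_pos hx ht
      have := mul_nonneg (neg_nonneg.mpr hy) hs.le
      linarith
  · by_cases hy : y ≤ 0
    · exact Or.inr (R hy (by linarith))
    · have hx : x ≤ 0 := by tauto
      push Not at hy
      have := mul_pos hy hs
      have := mul_nonneg (neg_nonneg.mpr hx) ht.le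
      linarith

lemma aux_triangle (n : ℕ)
    (v : ZMod n → ℤ × ℤ) (hv : IsCompleteSmoothFan n v) (c : ZMod n → ℤ)
    (M₁ M₂ : ℤ × ℤ) (hc : ∀ i, c i = max (-idot M₁ (v i)) (-idot M₂ (v i)))
    (h1 : dotR (vecR M₁) (vecR (v 1)) = -(c 1 : ℝ))
    (h2 : dotR (vecR M₂) (vecR (v 1)) = -(c 1 : ℝ))
    (k : ZMod n) (s t : ℝ) (hs : 0 < s) (ht : 0 < t)
    (h : -vecR (v 1) = s • vecR (v k) + t • vecR (v (k + 1)))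
    (hlt : dotR (vecR M₂) (vecR (v k)) < dotR (vecR M₁) (vecR (v k))) :
    (IsGGPgon n v c ∧
          ∃ (k : ZMod n) (p₁ p₂ p₃ : ℝ × ℝ),
            ¬ Collinear ℝ ({p₁, p₂, p₃} : Set (ℝ × ℝ)) ∧
            p₁ ∈ latticeR2 ∧ p₂ ∈ latticeR2 ∧ p₃ ∈ latticeR2 ∧
            Pgon n v c = convexHull ℝ {p₁, p₂, p₃} ∧
            Pgon n v c = {u | -(c 1 : ℝ) ≤ dotR u (vecR (v 1)) ∧
                -(c k : ℝ) ≤ dotR u (vecR (v k)) ∧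
                -(c (k + 1) : ℝ) ≤ dotR u (vecR (v (k + 1)))} ∧
            (∃ x ∈ face n v c 1, ∃ y ∈ face n v c 1, x ≠ y) ∧
            (∃ x ∈ face n v c k, ∃ y ∈ face n v c k, x ≠ y) ∧
            (∃ x ∈ face n v c (k + 1), ∃ y ∈ face n v c (k + 1), x ≠ y)) := by
  have hcR : ∀ i, (c i : ℝ) = max (-dotR (vecR M₁) (vecR (v i)))
      (-dotR (vecR M₂) (vecR (v i))) := by
    intro i; rw [hc i]; push_cast [idot_cast]; rfl
  have hdk : (v k).1 * (v (k+1)).2 - (v k).2 * (v (k+1)).1 = 1 := hv.2.1 k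
  have hdR : ((v k).1 : ℝ) * (v (k+1)).2 - (v k).2 * (v (k+1)).1 = 1 := by exact_mod_cast hdk
  have hdot : ∀ u, dotR u (vecR (v 1))
      = - (s * dotR u (vecR (v k)) + t * dotR u (vecR (v (k+1)))) := by
    intro u; rw [← aux_dot_add, ← h, aux_dot_neg]; ring
  have q1 := hdot (vecR M₁)
  have q2 := hdot (vecR M₂)
  have hlt' : dotR (vecR M₁) (vecR (v (k+1))) < dotR (vecR M₂) (vecR (v (k+1))) := by
    have := mul_lt_mul_of_pos_left hlt hs
    by_contra hcon
    push Not at hcon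
    have := mul_le_mul_of_nonneg_left hcon ht.le
    linarith
  have ck : (c k : ℝ) = - dotR (vecR M₂) (vecR (v k)) := by
    rw [hcR]; exact max_eq_right (by linarith)
  have ck1 : (c (k+1) : ℝ) = - dotR (vecR M₁) (vecR (v (k+1))) := by
    rw [hcR]; exact max_eq_left (by linarith)
  have m1P : vecR M₁ ∈ Pgon n v c := by
    intro i; rw [hcR]; have := le_max_left (-dotR (vecR M₁) (vecR (v i))) (-dotR (vecR M₂) (vecR (v i))); linarith
  have m2P : vecR M₂ ∈ Pgon n v c := by
    intro i; rw [hcR]; have := le_max_right (-dotR (vecR M₁) (vecR (v i))) (-dotR (vecR M₂) (vecR (v i))); linarith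
  have hT : Pgon n v c = {u | -(c 1 : ℝ) ≤ dotR u (vecR (v 1)) ∧
                -(c k : ℝ) ≤ dotR u (vecR (v k)) ∧
                -(c (k + 1) : ℝ) ≤ dotR u (vecR (v (k + 1)))} := by
    ext u
    refine ⟨fun hu => ⟨hu _, hu _, hu _⟩, ?_⟩
    rintro ⟨u1, u2, u3⟩ i
    rcases aux_cone n v hv k i s t hs ht h with ⟨α, β, ha, hb, e⟩ | ⟨α, β, ha, hb, e⟩
    · have := m1P i
      have e1 := aux_dot_add u (vecR (v 1)) (vecR (v (k+1))) α β
      have e2 := aux_dot_add (vecR M₁) (vecR (v 1)) (vecR (v (k+1))) α β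
      rw [← e] at e1 e2
      rw [e1]
      have i1 := mul_le_mul_of_nonneg_left u1 ha
      have i2 := mul_le_mul_of_nonneg_left u3 hb
      rw [ck1] at i2
      rw [h1] at e2
      linarith
    · have := m2P i
      have e1 := aux_dot_add u (vecR (v 1)) (vecR (v k)) α β
      have e2 := aux_dot_add (vecR M₂) (vecR (v 1)) (vecR (v k)) α β
      rw [← e] at e1 e2
      rw [e1]
      have i1 := mul_le_mul_of_nonneg_left u1 ha
      have i2 := mul_le_mul_of_nonneg_left u2 hb
      rw [ck] at i2
      rw [h2] at e2
      linarith
  obtain ⟨p, pk, pk1⟩ : ∃ p : ℤ × ℤ, dotR (vecR p) (vecR (v k)) = - (c k : ℝ) ∧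
      dotR (vecR p) (vecR (v (k+1))) = -(c (k+1) : ℝ) := by
    refine ⟨((v (k+1)).2 * (-c k) - (v k).2 * (-c (k+1)),
      -(v (k+1)).1 * (-c k) + (v k).1 * (-c (k+1))), ?_, ?_⟩
    · simp [dotR, vecR]; linear_combination (-(c k : ℝ)) * hdR
    · simp [dotR, vecR]; linear_combination (-(c (k+1) : ℝ)) * hdR
  have qp := hdot (vecR p)
  set D := s * (dotR (vecR M₁) (vecR (v k)) - dotR (vecR M₂) (vecR (v k))) with hD
  have Dpos : 0 < D := mul_pos hs (by linarith)
  have p1 : dotR (vecR p) (vecR (v 1)) = -(c 1 : ℝ) + D := by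
    rw [qp, pk, pk1, ck, ck1, ← h1, q1, hD]; ring
  have pP : vecR p ∈ Pgon n v c := by
    rw [hT]; exact ⟨by linarith, pk.ge, pk1.ge⟩
  have hp1 : vecR M₁ ≠ vecR p := by intro e; rw [← e] at p1; linarith
  have hp2 : vecR M₂ ≠ vecR p := by intro e; rw [← e] at p1; linarith
  have h12 : vecR M₁ ≠ vecR M₂ := by intro e; rw [e] at hlt; exact lt_irrefl _ hlt
  have hull : Pgon n v c = convexHull ℝ {vecR M₁, vecR M₂, vecR p} := by
    apply Set.Subset.antisymm
    · intro u hu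
      have f1 := hu 1
      have fk := hu k
      have fk1 := hu (k+1)
      have qu := hdot u
      have hsum : s * (dotR u (vecR (v k)) + c k) + t * (dotR u (vecR (v (k+1))) + c (k+1)) +
          (dotR u (vecR (v 1)) + c 1) = D := by
        rw [ck, ck1, hD]; linarith
      have t2 : t * (dotR (vecR M₂) (vecR (v (k+1))) - dotR (vecR M₁) (vecR (v (k+1)))) = D := by
        rw [hD]; linarith
      have hu_eq : u = (s * (dotR u (vecR (v k)) + c k) / D) • vecR M₁ +
          (t * (dotR u (vecR (v (k+1))) + c (k+1)) / D) • vecR M₂ +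
          ((dotR u (vecR (v 1)) + c 1) / D) • vecR p := by
        have hadd : ∀ (x y z : ℝ) (w : ℝ × ℝ), dotR (x • vecR M₁ + y • vecR M₂ + z • vecR p) w
            = x * dotR (vecR M₁) w + y * dotR (vecR M₂) w + z * dotR (vecR p) w := by
          intro x y z w; simp [dotR]; ring
        have D0 := Dpos.ne'
        apply aux_ext (vecR (v k)) (vecR (v (k+1))) _ _ hdR
        · rw [hadd, pk]
          generalize dotR u (vecR (v k)) = A at *
          generalize dotR u (vecR (v (k+1))) = B at *
          generalize dotR u (vecR (v 1)) = C at *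
          have hm2 : dotR (vecR M₂) (vecR (v k)) = - c k := by linarith
          have hm1 : s * dotR (vecR M₁) (vecR (v k)) = D - s * c k := by
            rw [hD, ck]; ring
          rw [hm2]
          field_simp
          linear_combination (c k : ℝ) * hsum - (A + c k) * hm1
        · rw [hadd, pk1]
          generalize dotR u (vecR (v k)) = A at *
          generalize dotR u (vecR (v (k+1))) = B at *
          generalize dotR u (vecR (v 1)) = C at *
          have hm1 : dotR (vecR M₁) (vecR (v (k+1))) = - c (k+1) := by linarith
          have hm2 : t * dotR (vecR M₂) (vecR (v (k+1))) = D - t * c (k+1) := by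
            rw [← t2, ck1]; ring
          rw [hm1]
          field_simp
          linear_combination (c (k+1) : ℝ) * hsum - (B + c (k+1)) * hm2
      have hcv := convex_convexHull ℝ ({vecR M₁, vecR M₂, vecR p} : Set (ℝ × ℝ))
      rw [hu_eq]
      have hsub := subset_convexHull ℝ ({vecR M₁, vecR M₂, vecR p} : Set (ℝ × ℝ))
      have := hcv.sum_mem (t := Finset.univ)
        (w := ![s * (dotR u (vecR (v k)) + c k) / D,
          t * (dotR u (vecR (v (k+1))) + c (k+1)) / D, (dotR u (vecR (v 1)) + c 1) / D])
        (z := ![vecR M₁, vecR M₂, vecR p]) ?_ ?_ ?_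
      · simpa [Fin.sum_univ_three] using this
      · intro i _
        fin_cases i
        · exact div_nonneg (mul_nonneg hs.le (by linarith)) Dpos.le
        · exact div_nonneg (mul_nonneg ht.le (by linarith)) Dpos.le
        · exact div_nonneg (by linarith) Dpos.le
      · simp only [Fin.sum_univ_three, Matrix.cons_val]
        rw [← add_div, ← add_div, hsum, div_self Dpos.ne']
      · intro i _
        apply hsub
        fin_cases i <;> simp
    · apply convexHull_min _ (aux_convex n v c)
      rintro x (rfl | rfl | rfl) <;> assumption
  refine ⟨⟨⟨_, m1P⟩, ?_, ?_⟩, k, vecR M₁, vecR M₂, vecR p, ?_, ⟨_, rfl⟩, ⟨_, rfl⟩, ⟨_, rfl⟩, hull,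
    hT, ⟨_, ⟨m1P, h1⟩, _, ⟨m2P, h2⟩, h12⟩, ⟨_, ⟨m2P, by linarith⟩, _, ⟨pP, pk⟩, hp2⟩,
    ⟨_, ⟨m1P, by linarith⟩, _, ⟨pP, pk1⟩, hp1⟩⟩
  · intro i
    rcases max_choice (-dotR (vecR M₁) (vecR (v i))) (-dotR (vecR M₂) (vecR (v i))) with e | e
    · exact ⟨_, m1P, by rw [hcR, e]; ring⟩
    · exact ⟨_, m2P, by rw [hcR, e]; ring⟩
  · intro u hu
    rw [hull] at hu
    rcases extremePoints_convexHull_subset hu with rfl | rfl | rfl <;> exact ⟨_, rfl⟩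
  · intro hcol
    rw [collinear_iff_of_mem (p₀ := vecR M₁) (by simp)] at hcol
    obtain ⟨w, hw⟩ := hcol
    obtain ⟨r2, e2⟩ := hw (vecR M₂) (by simp)
    obtain ⟨r3, e3⟩ := hw (vecR p) (by simp)
    have g : ∀ r : ℝ, dotR (r • w +ᵥ vecR M₁) (vecR (v 1))
        = r * dotR w (vecR (v 1)) + dotR (vecR M₁) (vecR (v 1)) := by
      intro r; simp [dotR]; ring
    have g2 := g r2
    have g3 := g r3
    rw [← e2, h2, h1] at g2
    rw [← e3, p1, h1] at g3
    have : r2 * dotR w (vecR (v 1)) = 0 := by linarith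
    rcases mul_eq_zero.mp this with h0 | h0
    · rw [h0] at e2; simp at e2; exact h12 e2.symm
    · rw [h0] at g3; linarith

/-- **Proposition (reduction to a lattice triangle or segment).** Let `P(b)`
be globally generated and two-dimensional, let `σ = σ_1(b)` be a
nondegenerate edge of `P(b)` with endpoints `m₁ ≠ m₂`, and let `q ∈ σ`.
Then there is `c` with `c 1 = b 1` and `c i ≤ b i` for all `i` such that
`q ∈ P(c) ⊆ P(b)`, both `m₁` and `m₂` are extreme points of `P(c)`, and
either `P(c) = σ`, or `P(c)` is globally generated and is a triangle with
lattice vertices cut out by the three half-planes with inner normals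
`v 1`, `v k`, `v (k+1)` for some `k`, each of the three corresponding faces
being a nondegenerate edge. -/
theorem prop_reduction_to_triangle (n : ℕ) (hn : 3 ≤ n)
    (v : ZMod n → ℤ × ℤ) (hv : IsCompleteSmoothFan n v) (b : ZMod n → ℤ)
    (hb : IsGGPgon n v b) (h2d : ¬ Collinear ℝ (Pgon n v b))
    (m₁ m₂ : ℝ × ℝ) (hm : m₁ ≠ m₂) (hσ : face n v b 1 = segment ℝ m₁ m₂)
    (q : ℝ × ℝ) (hq : q ∈ face n v b 1) :
    ∃ c : ZMod n → ℤ, c 1 = b 1 ∧ (∀ i, c i ≤ b i) ∧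
      q ∈ Pgon n v c ∧ Pgon n v c ⊆ Pgon n v b ∧
      m₁ ∈ Set.extremePoints ℝ (Pgon n v c) ∧
      m₂ ∈ Set.extremePoints ℝ (Pgon n v c) ∧
      (Pgon n v c = face n v b 1 ∨
        (IsGGPgon n v c ∧
          ∃ (k : ZMod n) (p₁ p₂ p₃ : ℝ × ℝ),
            ¬ Collinear ℝ ({p₁, p₂, p₃} : Set (ℝ × ℝ)) ∧
            p₁ ∈ latticeR2 ∧ p₂ ∈ latticeR2 ∧ p₃ ∈ latticeR2 ∧
            Pgon n v c = convexHull ℝ {p₁, p₂, p₃} ∧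
            Pgon n v c = {u | -(c 1 : ℝ) ≤ dotR u (vecR (v 1)) ∧
                -(c k : ℝ) ≤ dotR u (vecR (v k)) ∧
                -(c (k + 1) : ℝ) ≤ dotR u (vecR (v (k + 1)))} ∧
            (∃ x ∈ face n v c 1, ∃ y ∈ face n v c 1, x ≠ y) ∧
            (∃ x ∈ face n v c k, ∃ y ∈ face n v c k, x ≠ y) ∧
            (∃ x ∈ face n v c (k + 1), ∃ y ∈ face n v c (k + 1), x ≠ y))) := by
  have : NeZero n := ⟨by omega⟩
  have ex1 := aux_face_ext n v b 1 m₁ m₂ hσ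
  have ex2 := aux_face_ext n v b 1 m₂ m₁ (by rw [hσ, segment_symm])
  have hf1 : m₁ ∈ face n v b 1 := hσ ▸ left_mem_segment ℝ _ _
  have hf2 : m₂ ∈ face n v b 1 := hσ ▸ right_mem_segment ℝ _ _
  obtain ⟨M₁, rfl⟩ := hb.2.2 _ ex1
  obtain ⟨M₂, rfl⟩ := hb.2.2 _ ex2
  obtain ⟨c, hc⟩ : ∃ c : ZMod n → ℤ, ∀ i, c i = max (-idot M₁ (v i)) (-idot M₂ (v i)) :=
    ⟨_, fun _ => rfl⟩
  have hcR : ∀ i, (c i : ℝ) = max (-dotR (vecR M₁) (vecR (v i)))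
      (-dotR (vecR M₂) (vecR (v i))) := by
    intro i; rw [hc i]; push_cast [idot_cast]; rfl
  have hc1R : (c 1 : ℝ) = b 1 := by
    rw [hcR, hf1.2, hf2.2]; simp
  have hc1 : c 1 = b 1 := by exact_mod_cast hc1R
  have hle : ∀ i, c i ≤ b i := by
    intro i
    have : (c i : ℝ) ≤ b i := by
      rw [hcR]
      have := hf1.1 i
      have := hf2.1 i
      exact max_le (by linarith) (by linarith)
    exact_mod_cast this
  have hsub : Pgon n v c ⊆ Pgon n v b := by
    intro u hu i
    have h1 : (c i : ℝ) ≤ b i := by exact_mod_cast hle i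
    have := hu i
    linarith
  have m1P : vecR M₁ ∈ Pgon n v c := by
    intro i; rw [hcR]; have := le_max_left (-dotR (vecR M₁) (vecR (v i))) (-dotR (vecR M₂) (vecR (v i))); linarith
  have m2P : vecR M₂ ∈ Pgon n v c := by
    intro i; rw [hcR]; have := le_max_right (-dotR (vecR M₁) (vecR (v i))) (-dotR (vecR M₂) (vecR (v i))); linarith
  have hσP : face n v b 1 ⊆ Pgon n v c := by
    rw [hσ]; exact (aux_convex n v c).segment_subset m1P m2P
  refine ⟨c, hc1, hle, hσP hq, hsub,
    inter_extremePoints_subset_extremePoints_of_subset hsub ⟨m1P, ex1⟩,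
    inter_extremePoints_subset_extremePoints_of_subset hsub ⟨m2P, ex2⟩, ?_⟩
  have hne : -vecR (v 1) ≠ 0 := by
    intro h0
    have h1 := hv.2.1 1
    have a1 : (v 1).1 = 0 := by simpa [vecR] using congrArg Prod.fst h0
    have a2 : (v 1).2 = 0 := by simpa [vecR] using congrArg Prod.snd h0
    simp [a1, a2] at h1
  obtain ⟨k, ⟨s, t, hs, ht, h⟩, -⟩ := hv.2.2 _ hne
  have hdot : ∀ u, dotR u (vecR (v 1))
      = - (s * dotR u (vecR (v k)) + t * dotR u (vecR (v (k+1)))) := by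
    intro u; rw [← aux_dot_add, ← h, aux_dot_neg]; ring
  have q1 := hdot (vecR M₁)
  have q2 := hdot (vecR M₂)
  rw [hf1.2] at q1
  rw [hf2.2] at q2
  rcases hs.eq_or_lt with hs0 | hs0
  · left
    refine Set.Subset.antisymm ?_ hσP
    intro u hu
    refine ⟨hsub hu, ?_⟩
    have hb1 := hsub hu 1
    have hk := hu (k+1)
    have qu := hdot u
    subst hs0
    have e : dotR (vecR M₁) (vecR (v (k+1))) = dotR (vecR M₂) (vecR (v (k+1))) := by
      apply mul_left_cancel₀ ht.ne'
      linarith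
    rw [hcR, e, max_self] at hk
    have := mul_le_mul_of_nonneg_left hk ht.le
    linarith
  · right
    rcases lt_trichotomy (dotR (vecR M₁) (vecR (v k))) (dotR (vecR M₂) (vecR (v k))) with hl | hl | hl
    · exact aux_triangle n v hv c M₂ M₁ (fun i => by rw [hc i, max_comm]) (by rw [hf2.2, hc1])
        (by rw [hf1.2, hc1]) k s t hs0 ht h hl
    · exfalso
      apply hm
      refine aux_ext (vecR (v k)) (vecR (v (k+1))) _ _ ?_ hl ?_
      · have := hv.2.1 k
        simp only [vecR]; exact_mod_cast this
      · apply mul_left_cancel₀ ht.ne'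
        rw [hl] at q1
        linarith
    · exact aux_triangle n v hv c M₁ M₂ hc (by rw [hf1.2, hc1])
        (by rw [hf2.2, hc1]) k s t hs0 ht h hl
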